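/- The LDCU numerical flux exactly preserves isolated stationary contact waves: if U⁻ and U⁺ are admissible 1-D Euler states with u⁻ = u⁺ = 0 and equal pressures p⁻ = p⁺ = p (with arbitrary positive densities ρ⁻, ρ⁺), then u* = 0, α* = 1, the anti-diffusion term satisfies q^ρ = −a⁺a⁻(ρ⁺ − ρ⁻)/(a⁺ − a⁻) (the two arguments of the minmod being equal), and the LDCU numerical flux equals (0, p, 0), independently of ρ⁻ and ρ⁺. -/

import Mathlib

noncomputable section

namespace EulerCmp

/-- A 1-D Euler state in conserved variables `(ρ, ρu, E)`, recorded via `ρ`, `u`, `E`. -/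
structure State where
  ρ : ℝ
  u : ℝ
  E : ℝ

variable (γ : ℝ)

/-- Pressure from the equation of state `p = (γ-1)(E - ρ u²/2)`. -/
def pres (U : State) : ℝ := (γ - 1) * (U.E - U.ρ * U.u ^ 2 / 2)

/-- Admissibility: positive density and positive pressure. -/
def Admissible (U : State) : Prop := 0 < U.ρ ∧ 0 < pres γ U

/-- Sound speed `c = √(γ p / ρ)`. -/
def sound (U : State) : ℝ := Real.sqrt (γ * pres γ U / U.ρ)

/-- Conserved variable vector `U = (ρ, ρu, E)`. -/
def vec (U : State) : Fin 3 → ℝ := ![U.ρ, U.ρ * U.u, U.E]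

/-- Physical flux `F(U) = (ρu, ρu² + p, u(E+p))`. -/
def flux (U : State) : Fin 3 → ℝ :=
  ![U.ρ * U.u, U.ρ * U.u ^ 2 + pres γ U, U.u * (U.E + pres γ U)]

/-- LDCU right one-sided speed `a⁺ = max{u⁺+c⁺, u⁻+c⁻, 0}`. -/
def aP (Um Up : State) : ℝ := max (max (Up.u + sound γ Up) (Um.u + sound γ Um)) 0

/-- LDCU left one-sided speed `a⁻ = min{u⁺−c⁺, u⁻−c⁻, 0}`. -/
def aM (Um Up : State) : ℝ := min (min (Up.u - sound γ Up) (Um.u - sound γ Um)) 0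

/-- Intermediate state `U* = (a⁺U⁺ − a⁻U⁻ − (F(U⁺) − F(U⁻)))/(a⁺ − a⁻)`. -/
def uStarVec (Um Up : State) : Fin 3 → ℝ :=
  (aP γ Um Up - aM γ Um Up)⁻¹ •
    (aP γ Um Up • vec Up - aM γ Um Up • vec Um - (flux γ Up - flux γ Um))

/-- First component `ρ*` of the intermediate state. -/
def rhoStar (Um Up : State) : ℝ := uStarVec γ Um Up 0

/-- Second component `(ρu)*` of the intermediate state. -/
def mStar (Um Up : State) : ℝ := uStarVec γ Um Up 1

/-- Intermediate velocity `u* = (ρu)*/ρ*`. -/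
def uStar (Um Up : State) : ℝ := mStar γ Um Up / rhoStar γ Um Up

/-- Two-argument minmod: `minmod(a,b) = ((sgn a + sgn b)/2)·min(|a|,|b|)`. -/
def minmod2 (a b : ℝ) : ℝ := (Real.sign a + Real.sign b) / 2 * min |a| |b|

/-- Anti-diffusion density term
`q^ρ = minmod((u* − a⁻)(ρ* − ρ⁻), (a⁺ − u*)(ρ⁺ − ρ*))`. -/
def qRho (Um Up : State) : ℝ :=
  minmod2 ((uStar γ Um Up - aM γ Um Up) * (rhoStar γ Um Up - Um.ρ))
    ((aP γ Um Up - uStar γ Um Up) * (Up.ρ - rhoStar γ Um Up))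

/-- Coefficient `α*`. -/
def alphaStar (Um Up : State) : ℝ :=
  if uStar γ Um Up < 0 then aP γ Um Up / (aP γ Um Up - uStar γ Um Up)
  else aM γ Um Up / (aM γ Um Up - uStar γ Um Up)

/-- Anti-diffusion vector `q = α* q^ρ (1, u*, (u*)²/2)`. -/
def qVec (Um Up : State) : Fin 3 → ℝ :=
  (alphaStar γ Um Up * qRho γ Um Up) • ![1, uStar γ Um Up, (uStar γ Um Up) ^ 2 / 2]

/-- The LDCU numerical flux. -/
def ldcuFlux (Um Up : State) : Fin 3 → ℝ :=
  (aP γ Um Up - aM γ Um Up)⁻¹ •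
      (aP γ Um Up • flux γ Um - aM γ Um Up • flux γ Up)
    + (aP γ Um Up * aM γ Um Up / (aP γ Um Up - aM γ Um Up)) • (vec Up - vec Um)
    + qVec γ Um Up

theorem minmod2_self (a : ℝ) : minmod2 a a = a := by
  rcases lt_trichotomy a 0 with h | rfl | h
  · simp [minmod2, Real.sign_of_neg h, abs_of_neg h]
  · simp [minmod2]
  · simp [minmod2, Real.sign_of_pos h, abs_of_pos h]

theorem sound_pos {γ : ℝ} (hγ : 0 < γ) {U : State} (hU : Admissible γ U) : 0 < sound γ U :=
  Real.sqrt_pos.2 (div_pos (mul_pos hγ hU.2) hU.1)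

theorem flux_of_u_eq_zero {U : State} (hu : U.u = 0) : flux γ U = ![0, pres γ U, 0] := by
  simp [flux, hu]

theorem aP_pos_of_u_eq_zero {γ : ℝ} (hγ : 0 < γ) {Um Up : State} (hUm : Admissible γ Um)
    (hum : Um.u = 0) : 0 < aP γ Um Up := by
  simp [aP, hum, sound_pos hγ hUm]

theorem aM_neg_of_u_eq_zero {γ : ℝ} (hγ : 0 < γ) {Um Up : State} (hUm : Admissible γ Um)
    (hum : Um.u = 0) : aM γ Um Up < 0 := by
  simp [aM, hum, sound_pos hγ hUm]

theorem E_eq_of_pres_eq {γ : ℝ} (hγ : γ ≠ 1) {Um Up : State} (hum : Um.u = 0) (hup : Up.u = 0)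
    (hpp : pres γ Um = pres γ Up) : Um.E = Up.E := by
  simpa [pres, hum, hup, sub_ne_zero.2 hγ] using hpp

/-- The LDCU numerical flux exactly preserves isolated stationary contact waves: if
`u⁻ = u⁺ = 0` and `p⁻ = p⁺ = p`, then `u* = 0`, `α* = 1`, the two arguments of the
minmod in `q^ρ` are equal, `q^ρ = −a⁺a⁻(ρ⁺ − ρ⁻)/(a⁺ − a⁻)`, and the LDCU flux equals
`(0, p, 0)`, independently of the densities. -/
theorem ldcu_stationary_contact (hγ : 1 < γ) (Um Up : State)
    (hUm : Admissible γ Um) (hUp : Admissible γ Up)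
    (hum : Um.u = 0) (hup : Up.u = 0) (hpp : pres γ Um = pres γ Up) :
    uStar γ Um Up = 0 ∧
    alphaStar γ Um Up = 1 ∧
    (uStar γ Um Up - aM γ Um Up) * (rhoStar γ Um Up - Um.ρ)
      = (aP γ Um Up - uStar γ Um Up) * (Up.ρ - rhoStar γ Um Up) ∧
    qRho γ Um Up = -(aP γ Um Up * aM γ Um Up * (Up.ρ - Um.ρ)) / (aP γ Um Up - aM γ Um Up) ∧
    ldcuFlux γ Um Up = ![0, pres γ Um, 0] := by
  have hγ₀ : 0 < γ := one_pos.trans hγ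
  have hP : 0 < aP γ Um Up := aP_pos_of_u_eq_zero hγ₀ hUm hum
  have hM : aM γ Um Up < 0 := aM_neg_of_u_eq_zero hγ₀ hUm hum
  have hPM : aP γ Um Up - aM γ Um Up ≠ 0 := (sub_pos.2 (hM.trans hP)).ne'
  have hE : Um.E = Up.E := E_eq_of_pres_eq hγ.ne' hum hup hpp
  have hflux : flux γ Up = flux γ Um := by
    rw [flux_of_u_eq_zero γ hup, flux_of_u_eq_zero γ hum, hpp]
  have hu : uStar γ Um Up = 0 := by
    simp [uStar, mStar, uStarVec, vec, hflux, hum, hup]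
  have hα : alphaStar γ Um Up = 1 := by
    simp [alphaStar, hu, hM.ne]
  have hρ : rhoStar γ Um Up =
      (aP γ Um Up * Up.ρ - aM γ Um Up * Um.ρ) / (aP γ Um Up - aM γ Um Up) := by
    simp [rhoStar, uStarVec, vec, hflux, div_eq_inv_mul]
  have hargs : (uStar γ Um Up - aM γ Um Up) * (rhoStar γ Um Up - Um.ρ)
      = (aP γ Um Up - uStar γ Um Up) * (Up.ρ - rhoStar γ Um Up) := by
    rw [hu, hρ]
    field_simp
    ring
  have hq : qRho γ Um Up =
      -(aP γ Um Up * aM γ Um Up * (Up.ρ - Um.ρ)) / (aP γ Um Up - aM γ Um Up) := by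
    rw [qRho, hargs, minmod2_self, hu, hρ]
    field_simp
    ring
  refine ⟨hu, hα, hargs, hq, ?_⟩
  rw [ldcuFlux, qVec, hα, hq, hu, hflux, flux_of_u_eq_zero γ hum, ← sub_smul, smul_smul,
    inv_mul_cancel₀ hPM, one_smul]
  ext i
  fin_cases i
  · simp [vec]
    ring
  · simp [vec, hum, hup]
  · simp [vec, hE]

end EulerCmp
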